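/- arXiv:1703.00362 — 6 statements merged into one kernel-verified Lean document; each statement's English description precedes it below -/
import Mathlib

section
/- There exist a function N : ℝ → (0,∞) with Lip(N) ≤ 1/2 and a non-constant function f : ℝ → ℝ of bounded variation such that V(M^1_N f) = V(f). In particular, the constant 1 in the inequality V(M^1_N f) ≤ V(f) for Lip(N) ≤ 1/2 is sharp. -/
open MeasureTheory Set Filter Topology NNReal ENNReal

/-- The average of `|f|` over the interval `[y - t, y + t]`. -/
noncomputable def avgAbs (f : ℝ → ℝ) (y t : ℝ) : ℝ :=
  (1 / (2 * t)) * ∫ s in (y - t)..(y + t), |f s|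

/-- The `N`-truncated uncentered Hardy–Littlewood maximal function. -/
noncomputable def truncMax (N : ℝ → ℝ) (f : ℝ → ℝ) (x : ℝ) : ℝ :=
  sSup {r : ℝ | ∃ y t : ℝ, 0 < t ∧ |x - y| ≤ t ∧ t ≤ N x ∧ r = avgAbs f y t}

/-- A monotone function with values in `[0, 1]` attaining both `0` and `1` has variation `1`. -/
theorem Monotone.eVariationOn_univ_eq_one {g : ℝ → ℝ} (hg : Monotone g) (h0 : ∀ x, 0 ≤ g x)
    (h1 : ∀ x, g x ≤ 1) {a b : ℝ} (ha : g a = 0) (hb : g b = 1) :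
    eVariationOn g Set.univ = 1 := by
  apply le_antisymm
  · refine iSup_le fun ⟨n, u, hu, _⟩ => ?_
    have hmem : ∀ i ≤ n, u i ∈ Set.univ ∩ Set.Icc (u 0) (u n) := fun i hi =>
      ⟨Set.mem_univ _, hu (Nat.zero_le i), hu hi⟩
    calc ∑ i ∈ Finset.range n, edist (g (u (i + 1))) (g (u i))
        ≤ eVariationOn g (Set.univ ∩ Set.Icc (u 0) (u n)) :=
          eVariationOn.sum_le_of_monotoneOn_Iic (hu.monotoneOn _) hmem
      _ ≤ ENNReal.ofReal (g (u n) - g (u 0)) :=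
          ((hg.monotoneOn _).eVariationOn_eq (Set.mem_univ _) (Set.mem_univ _)).le
      _ ≤ 1 := by
          rw [ENNReal.ofReal_le_one]
          linarith [h0 (u 0), h1 (u n)]
  · have h := eVariationOn.edist_le g (Set.mem_univ b) (Set.mem_univ a)
    rwa [ha, hb, edist_dist, Real.dist_eq, sub_zero, abs_one, ENNReal.ofReal_one] at h

theorem avgAbs_nonneg (f : ℝ → ℝ) (y : ℝ) {t : ℝ} (ht : 0 < t) : 0 ≤ avgAbs f y t :=
  mul_nonneg (by positivity)
    (intervalIntegral.integral_nonneg (by linarith) fun _ _ => abs_nonneg _)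

theorem avgAbs_eq_of_ae_eq {f : ℝ → ℝ} {y t c : ℝ} (ht : 0 < t)
    (h : ∀ᵐ s, s ∈ Set.uIoc (y - t) (y + t) → |f s| = c) : avgAbs f y t = c := by
  rw [avgAbs, intervalIntegral.integral_congr_ae h, intervalIntegral.integral_const, smul_eq_mul]
  field_simp
  ring

theorem Monotone.avgAbs_le {f : ℝ → ℝ} (hf : Monotone f) (h0 : ∀ x, 0 ≤ f x) {y z t : ℝ}
    (ht : 0 < t) (hyz : y ≤ z) : avgAbs f y t ≤ avgAbs f z t := by
  have key : ∀ w, ∫ s in (w - t)..(w + t), |f s| = ∫ s in (-t)..t, f (s + w) := fun w => by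
    rw [intervalIntegral.integral_comp_add_right (fun s => f s)]
    simp only [abs_of_nonneg (h0 _)]
    congr 1 <;> ring
  have hint : ∀ w, IntervalIntegrable (fun s => f (s + w)) volume (-t) t := fun w =>
    Monotone.intervalIntegrable fun _ _ h => hf (by linarith)
  rw [avgAbs, avgAbs, key, key]
  exact mul_le_mul_of_nonneg_left (intervalIntegral.integral_mono_on (by linarith) (hint y)
    (hint z) fun s _ => hf (by linarith)) (by positivity)

theorem Monotone.avgAbs_le_one {f : ℝ → ℝ} (hf : Monotone f) (h0 : ∀ x, 0 ≤ f x)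
    (h1 : ∀ x, f x ≤ 1) (y : ℝ) {t : ℝ} (ht : 0 < t) : avgAbs f y t ≤ 1 := by
  have h : ∫ s in (y - t)..(y + t), |f s| ≤ ∫ _ in (y - t)..(y + t), (1 : ℝ) := by
    simp only [abs_of_nonneg (h0 _)]
    exact intervalIntegral.integral_mono_on (by linarith) hf.intervalIntegrable
      intervalIntegrable_const fun s _ => h1 s
  rw [intervalIntegral.integral_const, smul_eq_mul] at h
  rw [avgAbs, one_div, inv_mul_le_iff₀ (by positivity)]
  linarith

/-- There exist `N : ℝ → (0, ∞)` with `Lip(N) ≤ 1/2` and a non-constant function `f` of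
bounded variation with `V(M^1_N f) = V(f)`: the constant `1` in the inequality
`V(M^1_N f) ≤ V(f)` for `Lip(N) ≤ 1/2` is sharp. -/
theorem truncMax_sharpness :
    ∃ (N : ℝ → ℝ) (f : ℝ → ℝ), (∀ x, 0 < N x) ∧ LipschitzWith (1 / 2 : ℝ≥0) N ∧
      BoundedVariationOn f Set.univ ∧ (∃ a b : ℝ, f a ≠ f b) ∧
      eVariationOn (truncMax N f) Set.univ = eVariationOn f Set.univ := by
  set f : ℝ → ℝ := fun x => if 0 ≤ x then 1 else 0
  have hpos : ∀ x, 0 ≤ x → f x = 1 := fun x hx => if_pos hx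
  have hneg : ∀ x, x < 0 → f x = 0 := fun x hx => if_neg (not_le.2 hx)
  have h0 : ∀ x, 0 ≤ f x := fun x => by
    rcases le_or_gt 0 x with h | h <;> simp [hpos, hneg, h]
  have h1 : ∀ x, f x ≤ 1 := fun x => by
    rcases le_or_gt 0 x with h | h <;> simp [hpos, hneg, h]
  have hf : Monotone f := fun x y hxy => by
    rcases le_or_gt 0 x with h | h
    · rw [hpos x h, hpos y (h.trans hxy)]
    · rw [hneg x h]; exact h0 y
  have hfv : eVariationOn f Set.univ = 1 :=
    hf.eVariationOn_univ_eq_one h0 h1 (hneg (-1) (by norm_num)) (hpos 0 le_rfl)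
  have hle : ∀ x, ∀ r ∈ {r : ℝ | ∃ y t : ℝ, 0 < t ∧ |x - y| ≤ t ∧ t ≤ 1 ∧ r = avgAbs f y t},
      r ≤ 1 := by
    rintro x r ⟨y, t, ht, -, -, rfl⟩
    exact hf.avgAbs_le_one h0 h1 y ht
  have hbdd := fun x => (⟨1, hle x⟩ : BddAbove _)
  have hne : ∀ x,
      {r : ℝ | ∃ y t : ℝ, 0 < t ∧ |x - y| ≤ t ∧ t ≤ 1 ∧ r = avgAbs f y t}.Nonempty :=
    fun x => ⟨_, x, 1, one_pos, by simp, le_rfl, rfl⟩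
  have hM0 : ∀ x, 0 ≤ truncMax (fun _ => 1) f x := fun x => Real.sSup_nonneg <| by
    rintro r ⟨y, t, ht, -, -, rfl⟩
    exact avgAbs_nonneg f y ht
  have hM1 : ∀ x, truncMax (fun _ => 1) f x ≤ 1 := fun x => csSup_le (hne x) (hle x)
  have hM : Monotone (truncMax (fun _ => 1) f) := fun x z hxz => by
    refine csSup_le (hne x) ?_
    rintro r ⟨y, t, ht, hxy, ht1, rfl⟩
    refine (hf.avgAbs_le h0 ht (by linarith : y ≤ y + (z - x))).trans
      (le_csSup (hbdd z) ⟨y + (z - x), t, ht, ?_, ht1, rfl⟩)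
    rwa [show z - (y + (z - x)) = x - y by ring]
  have hMa : truncMax (fun _ => 1) f (-3) = 0 := by
    refine le_antisymm (csSup_le (hne _) ?_) (hM0 _)
    rintro r ⟨y, t, ht, hy, ht1, rfl⟩
    refine (avgAbs_eq_of_ae_eq ht (ae_of_all _ fun s hs => ?_)).le
    rw [Set.uIoc_of_le (by linarith)] at hs
    rw [hneg s (by linarith [hs.2, (abs_le.1 hy).1]), abs_zero]
  have hMb : truncMax (fun _ => 1) f 1 = 1 := by
    refine le_antisymm (hM1 _) (le_csSup (hbdd _) ⟨1, 1, one_pos, by simp, le_rfl, ?_⟩)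
    refine (avgAbs_eq_of_ae_eq one_pos (ae_of_all _ fun s hs => ?_)).symm
    rw [Set.uIoc_of_le (by linarith)] at hs
    rw [hpos s (by linarith [hs.1]), abs_one]
  refine ⟨fun _ => 1, f, fun _ => one_pos, LipschitzWith.const' 1, ?_, ⟨-1, 0, ?_⟩, ?_⟩
  · rw [BoundedVariationOn, hfv]
    exact ENNReal.one_ne_top
  · rw [hneg (-1) (by norm_num), hpos 0 le_rfl]
    exact zero_ne_one
  · rw [hfv, hM.eVariationOn_univ_eq_one hM0 hM1 hMa hMb]
end

section
/- Let c > 1/2 and let f = χ_{(-1,0)}. Then there exists a function N : ℝ → (0,∞) with Lip(N) = c such that V(M^1_N f) = +∞. -/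
open MeasureTheory Set Filter Topology NNReal ENNReal

/-- The Lipschitz constant `Lip(N) = sup_{x ≠ y} |N(x) - N(y)| / |x - y|`, valued in `ℝ≥0∞`. -/
noncomputable def lipConst (N : ℝ → ℝ) : ℝ≥0∞ :=
  ⨆ (x : ℝ) (y : ℝ) (_ : x ≠ y), ENNReal.ofReal (|N x - N y| / |x - y|)

lemma abs_indicator_Ioo_one (s : ℝ) :
    |Set.indicator (Set.Ioo (-1 : ℝ) 0) (fun _ => (1 : ℝ)) s| =
      Set.indicator (Set.Ioo (-1 : ℝ) 0) (fun _ => (1 : ℝ)) s :=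
  abs_of_nonneg (Set.indicator_nonneg (fun _ _ => zero_le_one) s)

lemma avgAbs_indicator (y t : ℝ) (ht : 0 < t) :
    avgAbs (Set.indicator (Set.Ioo (-1 : ℝ) 0) (fun _ => (1 : ℝ))) y t =
      1 / (2 * t) * volume.real (Set.Ioc (y - t) (y + t) ∩ Set.Ioo (-1 : ℝ) 0) := by
  unfold avgAbs
  simp_rw [abs_indicator_Ioo_one]
  rw [intervalIntegral.integral_of_le (by linarith), setIntegral_indicator measurableSet_Ioo]
  simp

lemma avgAbs_indicator_le_one (y t : ℝ) (ht : 0 < t) :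
    avgAbs (Set.indicator (Set.Ioo (-1 : ℝ) 0) (fun _ => (1 : ℝ))) y t ≤ 1 := by
  rw [avgAbs_indicator y t ht]
  have h : volume.real (Set.Ioc (y - t) (y + t) ∩ Set.Ioo (-1 : ℝ) 0) ≤ 2 * t := by
    refine (measureReal_mono Set.inter_subset_left measure_Ioc_lt_top.ne).trans ?_
    rw [Real.volume_real_Ioc_of_le (by linarith)]
    linarith
  rw [one_div_mul_eq_div, div_le_one (by linarith)]
  exact h

/-- If `N x` is too small to reach the support of `χ_{(-1,0)}`, the maximal function vanishes. -/
lemma truncMax_indicator_eq_zero (N : ℝ → ℝ) (x : ℝ) (h : N x ≤ x / 2) :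
    truncMax N (Set.indicator (Set.Ioo (-1 : ℝ) 0) (fun _ => (1 : ℝ))) x = 0 := by
  have key : ∀ r ∈ {r : ℝ | ∃ y t : ℝ, 0 < t ∧ |x - y| ≤ t ∧ t ≤ N x ∧
      r = avgAbs (Set.indicator (Set.Ioo (-1 : ℝ) 0) (fun _ => (1 : ℝ))) y t}, r = 0 := by
    rintro r ⟨y, t, ht, hxy, htN, rfl⟩
    have hy := (abs_le.1 hxy).2
    have hempty : Set.Ioc (y - t) (y + t) ∩ Set.Ioo (-1 : ℝ) 0 = ∅ := by
      ext s
      simp only [Set.mem_inter_iff, Set.mem_Ioc, Set.mem_Ioo, Set.mem_empty_iff_false, iff_false]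
      rintro ⟨⟨h1, -⟩, -, h2⟩
      linarith
    rw [avgAbs_indicator y t ht, hempty]
    simp
  exact le_antisymm (Real.sSup_nonpos fun r hr => (key r hr).le)
    (Real.sSup_nonneg fun r hr => (key r hr).ge)

/-- If `N x` is large enough to cover the support, the average over `[-1, x]` is a competitor. -/
lemma one_div_le_truncMax_indicator (N : ℝ → ℝ) (x : ℝ) (hx : 0 ≤ x) (h : (x + 1) / 2 ≤ N x) :
    1 / (x + 1) ≤ truncMax N (Set.indicator (Set.Ioo (-1 : ℝ) 0) (fun _ => (1 : ℝ))) x := by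
  refine le_csSup ⟨1, ?_⟩ ⟨(x - 1) / 2, (x + 1) / 2, by linarith, ?_, h, ?_⟩
  · rintro r ⟨y, t, ht, -, -, rfl⟩
    exact avgAbs_indicator_le_one y t ht
  · exact abs_le.2 ⟨by linarith, by linarith⟩
  · rw [avgAbs_indicator _ _ (by linarith)]
    have hI : Set.Ioc ((x - 1) / 2 - (x + 1) / 2) ((x - 1) / 2 + (x + 1) / 2) ∩
        Set.Ioo (-1 : ℝ) 0 = Set.Ioo (-1 : ℝ) 0 := by
      refine Set.inter_eq_right.2 fun s hs => ⟨?_, ?_⟩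
      · linarith [hs.1]
      · linarith [hs.2]
    rw [hI, Real.volume_real_Ioo_of_le (by norm_num)]
    ring

/-- A truncation with slopes in `[1/2 - a, 1/2 + a]` oscillating about `|x| / 2 + 1`. -/
noncomputable def sineTruncation (a x : ℝ) : ℝ :=
  |x| / 2 + 1 + Real.sin (a * |x|)

lemma sineTruncation_pos (a x : ℝ) : 0 < sineTruncation a x := by
  unfold sineTruncation
  rcases eq_or_ne x 0 with rfl | hx
  · simp
  · linarith [abs_pos.2 hx, Real.neg_one_le_sin (a * |x|)]

lemma abs_sineTruncation_sub_le (a : ℝ) (ha : 0 ≤ a) (x y : ℝ) :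
    |sineTruncation a x - sineTruncation a y| ≤ (1 / 2 + a) * |x - y| := by
  have hsin : |Real.sin (a * |x|) - Real.sin (a * |y|)| ≤ a * |(|x| - |y|)| := by
    have := Real.abs_sin_sub_sin_le (a * |x|) (a * |y|)
    rwa [← mul_sub, abs_mul, abs_of_nonneg ha] at this
  calc |sineTruncation a x - sineTruncation a y|
      = |(|x| - |y|) / 2 + (Real.sin (a * |x|) - Real.sin (a * |y|))| := by
        unfold sineTruncation; congr 1; ring
    _ ≤ |(|x| - |y|) / 2| + |Real.sin (a * |x|) - Real.sin (a * |y|)| := abs_add_le _ _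
    _ ≤ |(|x| - |y|)| / 2 + a * |(|x| - |y|)| := by
        rw [abs_div, abs_two]; gcongr
    _ = (1 / 2 + a) * |(|x| - |y|)| := by ring
    _ ≤ (1 / 2 + a) * |x - y| := by
        exact mul_le_mul_of_nonneg_left (abs_abs_sub_abs_le x y) (by positivity)

lemma lipConst_sineTruncation (a : ℝ) (ha : 0 ≤ a) :
    lipConst (sineTruncation a) = ENNReal.ofReal (1 / 2 + a) := by
  refine le_antisymm ?_ ?_
  · refine iSup_le fun x => iSup_le fun y => iSup_le fun hxy => ENNReal.ofReal_le_ofReal ?_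
    rw [div_le_iff₀ (abs_pos.2 (sub_ne_zero.2 hxy))]
    exact abs_sineTruncation_sub_le a ha x y
  · have hderiv : HasDerivAt (fun x : ℝ => x / 2 + 1 + Real.sin (a * x)) (1 / 2 + a) 0 := by
      have h1 := ((hasDerivAt_id (0 : ℝ)).div_const 2).add_const 1
      have h2 := ((hasDerivAt_id (0 : ℝ)).const_mul a).sin
      have h3 := h1.fun_add h2
      simp only [id_eq, mul_zero, Real.cos_zero, one_mul, mul_one] at h3
      exact h3
    have ht := hderiv.tendsto_slope.mono_left
      (nhdsWithin_mono (0 : ℝ) (fun x (hx : x ∈ Set.Ioi (0 : ℝ)) => (ne_of_gt hx : x ≠ 0)))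
    refine le_of_tendsto ((ENNReal.continuous_ofReal.tendsto _).comp ht) ?_
    filter_upwards [self_mem_nhdsWithin] with x hx
    have hx0 : (0 : ℝ) < x := hx
    refine le_trans (ENNReal.ofReal_le_ofReal ?_)
      (le_iSup_of_le x (le_iSup_of_le 0 (le_iSup_of_le hx0.ne' le_rfl)))
    rw [slope_def_field, ← abs_div]
    refine le_of_eq_of_le ?_ (le_abs_self _)
    simp [sineTruncation, abs_of_pos hx0]

/-- A function on `ℝ` has infinite variation if along a monotone sequence its consecutive
increments dominate a multiple of the harmonic series. -/
lemma eVariationOn_univ_eq_top_of_harmonic_le (g : ℝ → ℝ) (u : ℕ → ℝ) (hu : Monotone u)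
    (K : ℝ) (hK : 0 < K) (h : ∀ n : ℕ, K * (1 / ((n : ℝ) + 1)) ≤ |g (u (n + 1)) - g (u n)|) :
    eVariationOn g Set.univ = ⊤ := by
  refine ENNReal.eq_top_of_forall_nnreal_le fun r => ?_
  have ht := Real.tendsto_sum_range_one_div_nat_succ_atTop.const_mul_atTop hK
  obtain ⟨n, hn⟩ := (ht.eventually_ge_atTop (r : ℝ)).exists
  refine le_trans ?_ (eVariationOn.sum_le (f := g) (s := Set.univ) (n := n) hu fun _ => mem_univ _)
  calc (r : ℝ≥0∞) = ENNReal.ofReal r := (ENNReal.ofReal_coe_nnreal).symm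
    _ ≤ ENNReal.ofReal (∑ i ∈ Finset.range n, |g (u (i + 1)) - g (u i)|) := by
        refine ENNReal.ofReal_le_ofReal (hn.trans ?_)
        rw [Finset.mul_sum]
        exact Finset.sum_le_sum fun i _ => h i
    _ = ∑ i ∈ Finset.range n, edist (g (u (i + 1))) (g (u i)) := by
        rw [ENNReal.ofReal_sum_of_nonneg fun _ _ => abs_nonneg _]
        simp_rw [edist_dist, Real.dist_eq]

/-- For every `c > 1/2` there is a function `N : ℝ → (0, ∞)` with `Lip(N) = c` such that the
truncated maximal function of `f = χ_{(-1,0)}` has infinite total variation. -/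
theorem truncMax_infinite_variation (c : ℝ) (hc : 1 / 2 < c) :
    ∃ N : ℝ → ℝ, (∀ x, 0 < N x) ∧ lipConst N = ENNReal.ofReal c ∧
      eVariationOn (truncMax N (Set.indicator (Set.Ioo (-1 : ℝ) 0) (fun _ => (1 : ℝ))))
        Set.univ = ⊤ := by
  obtain ⟨a, ha, rfl⟩ : ∃ a : ℝ, 0 < a ∧ c = 1 / 2 + a := ⟨c - 1 / 2, by linarith, by ring⟩
  refine ⟨sineTruncation a, sineTruncation_pos a, lipConst_sineTruncation a ha.le, ?_⟩
  have hpi := Real.pi_pos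
  set u : ℕ → ℝ := fun n => (n * Real.pi + 3 * Real.pi / 2) / a with hu
  have hu0 : ∀ n, 0 ≤ u n := fun n => by positivity
  have hmono : Monotone u := fun m n hmn => by
    have : (m : ℝ) ≤ n := by exact_mod_cast hmn
    simp only [hu]
    gcongr
  have hN : ∀ n : ℕ, sineTruncation a (u n) = u n / 2 + 1 - (-1) ^ n := fun n => by
    have h1 : a * u n = n * Real.pi + 3 * Real.pi / 2 := by simp only [hu]; field_simp
    have h2 : Real.sin (3 * Real.pi / 2) = -1 := by
      rw [show 3 * Real.pi / 2 = Real.pi / 2 + Real.pi by ring, Real.sin_add_pi,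
        Real.sin_pi_div_two]
    rw [sineTruncation, abs_of_nonneg (hu0 n), h1, add_comm ((n : ℝ) * Real.pi),
      Real.sin_add_nat_mul_pi, h2]
    ring
  have heven : ∀ n : ℕ, Even n → truncMax (sineTruncation a)
      (Set.indicator (Set.Ioo (-1 : ℝ) 0) (fun _ => (1 : ℝ))) (u n) = 0 := fun n hn =>
    truncMax_indicator_eq_zero _ _ (by rw [hN, hn.neg_one_pow]; linarith)
  have hodd : ∀ n : ℕ, Odd n → 1 / (u n + 1) ≤ truncMax (sineTruncation a)
      (Set.indicator (Set.Ioo (-1 : ℝ) 0) (fun _ => (1 : ℝ))) (u n) := fun n hn =>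
    one_div_le_truncMax_indicator _ _ (hu0 n) (by rw [hN, hn.neg_one_pow]; linarith)
  refine eVariationOn_univ_eq_top_of_harmonic_le _ u hmono (1 / (u 1 + 1))
    (by have := hu0 1; positivity) fun n => ?_
  have hbound : 1 / (u 1 + 1) * (1 / ((n : ℝ) + 1)) ≤ 1 / (u (n + 1) + 1) := by
    rw [one_div_mul_one_div]
    have h1 := hu0 (n + 1)
    refine one_div_le_one_div_of_le (by linarith) ?_
    have h2 : u (n + 1) = u 1 + n * (Real.pi / a) := by simp only [hu]; push_cast; ring
    have h3 : Real.pi / a ≤ u 1 := by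
      simp only [hu]; gcongr; push_cast; linarith
    have h4 := mul_le_mul_of_nonneg_left h3 (Nat.cast_nonneg (α := ℝ) n)
    have h5 : (0 : ℝ) ≤ n := Nat.cast_nonneg n
    rw [h2]
    linarith
  refine hbound.trans ?_
  rcases Nat.even_or_odd n with hn | hn
  · rw [heven n hn, sub_zero]
    exact (hodd _ hn.add_one).trans (le_abs_self _)
  · rw [heven _ hn.add_one, zero_sub, abs_neg]
    refine le_trans (one_div_le_one_div_of_le ?_ ?_) ((hodd n hn).trans (le_abs_self _))
    · linarith [hu0 n]
    · linarith [hmono n.le_succ]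
end

section
/- Let f : ℝ → ℝ be nonnegative and locally integrable, let R > 0 and x ∈ ℝ. Then sup{ u(z,t) : t > 0, |z-x| + |t-R| ≤ R } ≤ max{ M_{r,R} f(x), M_{l,R} f(x) }. -/
open MeasureTheory Set Filter Topology NNReal ENNReal

/-- The average of `f` over the interval `[y - t, y + t]`. -/
noncomputable def avgOf (f : ℝ → ℝ) (y t : ℝ) : ℝ :=
  (1 / (2 * t)) * ∫ s in (y - t)..(y + t), f s

/-- The one-sided right truncated maximal function
`M_{r,R} f (x) = sup_{0 < t ≤ 2R} (1/t) ∫_x^{x+t} f`. -/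
noncomputable def Mright (f : ℝ → ℝ) (R x : ℝ) : ℝ≥0∞ :=
  ⨆ (t : ℝ) (_ : 0 < t ∧ t ≤ 2 * R), ENNReal.ofReal ((1 / t) * ∫ s in x..(x + t), f s)

/-- The one-sided left truncated maximal function
`M_{l,R} f (x) = sup_{0 < t ≤ 2R} (1/t) ∫_{x-t}^x f`. -/
noncomputable def Mleft (f : ℝ → ℝ) (R x : ℝ) : ℝ≥0∞ :=
  ⨆ (t : ℝ) (_ : 0 < t ∧ t ≤ 2 * R), ENNReal.ofReal ((1 / t) * ∫ s in (x - t)..x, f s)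

/-- For `f` nonnegative and locally integrable, `R > 0` and `x ∈ ℝ`, the supremum of the
averages `u(z,t)` over the rotated square `{(z,t) : |z - x| + |t - R| ≤ R}` is bounded by
the larger of the two one-sided truncated maximal functions at `x`. -/
theorem square_sup_le_max_onesided (f : ℝ → ℝ) (hf0 : ∀ s, 0 ≤ f s)
    (hloc : MeasureTheory.LocallyIntegrable f MeasureTheory.volume)
    (R : ℝ) (hR : 0 < R) (x : ℝ) :
    (⨆ (z : ℝ) (t : ℝ) (_ : 0 < t ∧ |z - x| + |t - R| ≤ R), ENNReal.ofReal (avgOf f z t)) ≤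
      max (Mright f R x) (Mleft f R x) := by
  refine iSup_le fun z => iSup_le fun t => iSup_le fun ⟨ht, h⟩ => ?_
  have hint : ∀ a b : ℝ, IntervalIntegrable f volume a b := fun a b =>
    (hloc.integrableOn_isCompact isCompact_uIcc).intervalIntegrable
  have hbounds : 0 ≤ x - (z - t) ∧ 0 ≤ z + t - x ∧ x - (z - t) ≤ 2 * R ∧ z + t - x ≤ 2 * R := by
    refine ⟨?_, ?_, ?_, ?_⟩ <;>
      cases abs_cases (z - x) <;> cases abs_cases (t - R) <;> linarith
  obtain ⟨ha, hb, haR, hbR⟩ := hbounds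
  have hsum : (∫ s in (z - t)..x, f s) + ∫ s in x..(z + t), f s = avgOf f z t * (2 * t) := by
    rw [intervalIntegral.integral_add_adjacent_intervals (hint _ _) (hint _ _), avgOf]
    field_simp
  by_cases hright : 0 < z + t - x ∧ avgOf f z t * (z + t - x) ≤ ∫ s in x..(z + t), f s
  · obtain ⟨hb_pos, hle⟩ := hright
    refine le_max_of_le_left (le_iSup₂_of_le (z + t - x) ⟨hb_pos, hbR⟩ ?_)
    apply ENNReal.ofReal_le_ofReal
    rw [add_sub_cancel, one_div, inv_mul_eq_div, le_div_iff₀ hb_pos]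
    exact hle
  by_cases hleft : 0 < x - (z - t) ∧ avgOf f z t * (x - (z - t)) ≤ ∫ s in (z - t)..x, f s
  · obtain ⟨ha_pos, hle⟩ := hleft
    refine le_max_of_le_right (le_iSup₂_of_le (x - (z - t)) ⟨ha_pos, haR⟩ ?_)
    apply ENNReal.ofReal_le_ofReal
    rw [_root_.sub_sub_cancel, one_div, inv_mul_eq_div, le_div_iff₀ ha_pos]
    exact hle
  exfalso
  rcases hb.eq_or_lt with hb_zero | hb_pos
  · have hx : x = z + t := by linarith
    subst hx
    rw [intervalIntegral.integral_same] at hsum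
    exact hleft ⟨by linarith, by linarith⟩
  · have hlt := not_le.mp fun hle => hright ⟨hb_pos, hle⟩
    rcases ha.eq_or_lt with ha_zero | ha_pos
    · have hx : x = z - t := by linarith
      subst hx
      rw [intervalIntegral.integral_same] at hsum
      linarith
    · have hlt_left := not_le.mp fun hle => hleft ⟨ha_pos, hle⟩
      linarith
end

section
/- Let f : ℝ → ℝ be nonnegative and locally integrable, let R > 0 and x ∈ ℝ. Then the truncated uncentered maximal function satisfies M^1_{≡R} f(x) = sup{ u(z,t) : t > 0, |z-x| + |t-R| ≤ R }; that is, the region of the upper half-plane determining M^1_{≡R} f(x) is the rotated square {(z,t) : |z-x| + |t-R| ≤ R} rather than the triangle {(z,t) : |z-x| ≤ t ≤ R}. -/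
open MeasureTheory Set Filter Topology NNReal ENNReal

/-- The truncated uncentered Hardy–Littlewood maximal function
`M^1_{≡R} f (x) = sup { u(y,t) : 0 < t, |x - y| ≤ t ≤ R }`. -/
noncomputable def truncUncMax (R : ℝ) (f : ℝ → ℝ) (x : ℝ) : ℝ≥0∞ :=
  ⨆ (y : ℝ) (t : ℝ) (_ : 0 < t ∧ |x - y| ≤ t ∧ t ≤ R), ENNReal.ofReal (avgOf f y t)

/-- The average over an interval is at most the larger of the averages over the two intervals
obtained by cutting it at an interior point. -/
theorem avgOf_le_max_of_mem_Ioo {f : ℝ → ℝ} (hloc : LocallyIntegrable f volume)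
    {z t x : ℝ} (h₁ : z - t < x) (h₂ : x < z + t) :
    avgOf f z t ≤ max (avgOf f ((z - t + x) / 2) ((x - (z - t)) / 2))
      (avgOf f ((x + (z + t)) / 2) ((z + t - x) / 2)) := by
  have hint (a b : ℝ) : IntervalIntegrable f volume a b :=
    (hloc.integrableOn_isCompact isCompact_uIcc).intervalIntegrable
  have hsplit := intervalIntegral.integral_add_adjacent_intervals (hint (z - t) x) (hint x (z + t))
  have ht : 0 < t := by linarith
  have hl : 0 < x - (z - t) := by linarith
  have hr : 0 < z + t - x := by linarith
  unfold avgOf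
  rw [show (z - t + x) / 2 - (x - (z - t)) / 2 = z - t by ring,
    show (z - t + x) / 2 + (x - (z - t)) / 2 = x by ring,
    show (x + (z + t)) / 2 - (z + t - x) / 2 = x by ring,
    show (x + (z + t)) / 2 + (z + t - x) / 2 = z + t by ring,
    mul_div_cancel₀ _ (two_ne_zero : (2 : ℝ) ≠ 0), mul_div_cancel₀ _ (two_ne_zero : (2 : ℝ) ≠ 0),
    ← hsplit, one_div_mul_eq_div, one_div_mul_eq_div, one_div_mul_eq_div,
    div_le_iff₀ (by positivity)]
  set I := ∫ s in (z - t)..x, f s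
  set J := ∫ s in x..(z + t), f s
  have hI := (div_le_iff₀ hl).1 (le_max_left (I / (x - (z - t))) (J / (z + t - x)))
  have hJ := (div_le_iff₀ hr).1 (le_max_right (I / (x - (z - t))) (J / (z + t - x)))
  linarith

/-- An average that is admissible for the truncated maximal function is bounded by it. -/
theorem ofReal_avgOf_le_truncUncMax (f : ℝ → ℝ) {R x y t : ℝ} (ht : 0 < t) (hxy : |x - y| ≤ t)
    (htR : t ≤ R) : ENNReal.ofReal (avgOf f y t) ≤ truncUncMax R f x :=
  le_iSup_of_le y <| le_iSup_of_le t <| le_iSup_of_le ⟨ht, hxy, htR⟩ le_rfl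

/-- For `f` nonnegative and locally integrable, `R > 0` and `x ∈ ℝ`, the truncated uncentered
maximal function equals the supremum of the averages over the rotated square
`{(z,t) : |z - x| + |t - R| ≤ R}` (and not merely over the triangle `{(z,t) : |z-x| ≤ t ≤ R}`). -/
theorem truncUncMax_eq_square_sup (f : ℝ → ℝ) (hf0 : ∀ s, 0 ≤ f s)
    (hloc : MeasureTheory.LocallyIntegrable f MeasureTheory.volume)
    (R : ℝ) (hR : 0 < R) (x : ℝ) :
    truncUncMax R f x =
      ⨆ (z : ℝ) (t : ℝ) (_ : 0 < t ∧ |z - x| + |t - R| ≤ R), ENNReal.ofReal (avgOf f z t) := by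
  apply le_antisymm
  · refine iSup_le fun y => iSup_le fun t => iSup_le fun ⟨ht, hxy, htR⟩ => ?_
    refine le_iSup_of_le y <| le_iSup_of_le t <| le_iSup_of_le ⟨ht, ?_⟩ le_rfl
    rw [abs_sub_comm y x, abs_of_nonpos (by linarith : t - R ≤ 0)]
    linarith
  · refine iSup_le fun z => iSup_le fun t => iSup_le fun ⟨ht, hzt⟩ => ?_
    rcases le_total t R with htR | htR
    · rw [abs_sub_comm z x, abs_of_nonpos (by linarith : t - R ≤ 0)] at hzt
      exact ofReal_avgOf_le_truncUncMax f ht (by linarith) htR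
    · rw [abs_of_nonneg (by linarith : 0 ≤ t - R)] at hzt
      obtain ⟨hz₁, hz₂⟩ := abs_le.1 (by linarith : |z - x| ≤ 2 * R - t)
      rcases eq_or_lt_of_le htR with rfl | htR
      · exact ofReal_avgOf_le_truncUncMax f ht (by rw [abs_sub_comm]; linarith) le_rfl
      · refine (ENNReal.ofReal_le_ofReal
          (avgOf_le_max_of_mem_Ioo (x := x) hloc (by linarith) (by linarith))).trans ?_
        rw [ENNReal.ofReal_max]
        refine max_le ?_ ?_
        · exact ofReal_avgOf_le_truncUncMax f (by linarith)
            (abs_le.2 ⟨by linarith, by linarith⟩) (by linarith)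
        · exact ofReal_avgOf_le_truncUncMax f (by linarith)
            (abs_le.2 ⟨by linarith, by linarith⟩) (by linarith)
end

section
/- (Reduction to the Lipschitz case) Fix α ∈ [0,1]. Suppose that V(M^α f) ≤ V(f) holds for every Lipschitz function f : ℝ → ℝ of bounded variation. Then V(M^α f) ≤ V(f) holds for every function f : ℝ → ℝ of bounded variation normalized so that f(x) = limsup_{y→x} f(y) for all x ∈ ℝ. -/
open MeasureTheory Set Filter Topology NNReal ENNReal

/-- The nontangential Hardy–Littlewood maximal function. -/
noncomputable def ntMax (α : ℝ) (f : ℝ → ℝ) (x : ℝ) : ℝ :=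
  sSup {r : ℝ | ∃ y t : ℝ, 0 < t ∧ |x - y| ≤ α * t ∧ r = avgAbs f y t}

section MaximalFunction

variable {α C x y t r : ℝ} {f : ℝ → ℝ}

lemma intervalIntegrable_of_abs_le (hf : Measurable f) (hC : ∀ x, |f x| ≤ C) (a b : ℝ) :
    IntervalIntegrable f volume a b :=
  (intervalIntegrable_const (c := C)).mono_fun hf.aestronglyMeasurable
    (Eventually.of_forall fun x => (hC x).trans (le_abs_self C))

lemma abs_integral_shift_sub_le (hf : Measurable f) (hC : ∀ x, |f x| ≤ C) (a b c : ℝ) :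
    |(∫ s in (a + c)..(b + c), f s) - ∫ s in a..b, f s| ≤ 2 * C * |c| := by
  have hi := intervalIntegrable_of_abs_le hf hC
  rw [intervalIntegral.integral_interval_sub_interval_comm (hi _ _) (hi _ _) (hi _ _)]
  have h1 := intervalIntegral.norm_integral_le_of_norm_le_const (a := a + c) (b := a) (f := f)
    fun x _ => hC x
  have h2 := intervalIntegral.norm_integral_le_of_norm_le_const (a := b + c) (b := b) (f := f)
    fun x _ => hC x
  simp only [sub_add_cancel_left, abs_neg, Real.norm_eq_abs] at h1 h2
  linarith [abs_sub (∫ s in (a + c)..a, f s) (∫ s in (b + c)..b, f s)]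

lemma avgAbs_le_of_abs_le (hC : ∀ x, |f x| ≤ C) (ht : 0 < t) : avgAbs f y t ≤ C := by
  have h := intervalIntegral.norm_integral_le_of_norm_le_const (a := y - t) (b := y + t)
    (f := fun s => |f s|) (C := C) fun x _ => by simpa using hC x
  have h' := (le_abs_self _).trans h
  rw [show y + t - (y - t) = 2 * t by ring, abs_of_pos (by positivity : 0 < 2 * t)] at h'
  rw [avgAbs, one_div, inv_mul_le_iff₀ (by positivity)]
  linarith

lemma avgAbs_le_ntMax (hC : ∀ x, |f x| ≤ C) (ht : 0 < t) (hxy : |x - y| ≤ α * t) :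
    avgAbs f y t ≤ ntMax α f x := by
  refine le_csSup ⟨C, ?_⟩ ⟨y, t, ht, hxy, rfl⟩
  rintro _ ⟨y, t, ht, -, rfl⟩
  exact avgAbs_le_of_abs_le hC ht

lemma setOf_avgAbs_nonempty (hα : 0 ≤ α) (f : ℝ → ℝ) (x : ℝ) :
    {r : ℝ | ∃ y t : ℝ, 0 < t ∧ |x - y| ≤ α * t ∧ r = avgAbs f y t}.Nonempty :=
  ⟨_, x, 1, one_pos, by simpa using hα, rfl⟩

lemma ntMax_le (hα : 0 ≤ α) (h : ∀ y t, 0 < t → |x - y| ≤ α * t → avgAbs f y t ≤ r) :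
    ntMax α f x ≤ r := by
  refine csSup_le (setOf_avgAbs_nonempty hα f x) ?_
  rintro _ ⟨y, t, ht, hxy, rfl⟩
  exact h y t ht hxy

lemma exists_lt_avgAbs (hα : 0 ≤ α) (h : r < ntMax α f x) :
    ∃ y t, 0 < t ∧ |x - y| ≤ α * t ∧ r < avgAbs f y t := by
  obtain ⟨_, ⟨y, t, ht, hxy, rfl⟩, hr⟩ := exists_lt_of_lt_csSup (setOf_avgAbs_nonempty hα f x) h
  exact ⟨y, t, ht, hxy, hr⟩

lemma abs_avgAbs_shift_sub_le (hf : Measurable f) (hC : ∀ x, |f x| ≤ C) (ht : 0 < t) (c : ℝ) :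
    |avgAbs f (y + c) t - avgAbs f y t| ≤ C * |c| / t := by
  have h := abs_integral_shift_sub_le (f := fun s => |f s|) hf.abs (C := C)
    (fun x => by simpa using hC x) (y - t) (y + t) c
  rw [avgAbs, avgAbs, ← mul_sub, abs_mul, abs_of_pos (by positivity : 0 < 1 / (2 * t)),
    one_div, inv_mul_le_iff₀ (by positivity), show y + c - t = y - t + c by ring,
    show y + c + t = y + t + c by ring]
  refine h.trans (le_of_eq ?_)
  field_simp

lemma ntMax_eventually_ge (hα : 0 ≤ α) (hf : Measurable f) (hC : ∀ x, |f x| ≤ C) (x : ℝ)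
    {ε : ℝ} (hε : 0 < ε) : ∀ᶠ x' in 𝓝 x, ntMax α f x - ε ≤ ntMax α f x' := by
  obtain ⟨y, t, ht, hxy, hlt⟩ := exists_lt_avgAbs hα (show ntMax α f x - ε / 2 < ntMax α f x by
    linarith)
  have hlim : Tendsto (fun x' => C * |x' - x| / t) (𝓝 x) (𝓝 0) := by
    have : Continuous fun x' => C * |x' - x| / t := by fun_prop
    simpa using this.tendsto x
  filter_upwards [hlim.eventually_lt_const (half_pos hε)] with x' hx'
  have h1 := abs_avgAbs_shift_sub_le (y := y) hf hC ht (x' - x)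
  have h2 : avgAbs f (y + (x' - x)) t ≤ ntMax α f x' :=
    avgAbs_le_ntMax hC ht (by rwa [show x' - (y + (x' - x)) = x - y by ring])
  linarith [(abs_le.1 h1).1]

/-- If `|f|` is nearly monotone in the direction `σ` near `x`, then the maximal function is
upper semicontinuous at `x` from the side opposite to `σ`. -/
lemma ntMax_eventually_le (hα : α ∈ Icc (0 : ℝ) 1) (hf : Measurable f) (hC : ∀ x, |f x| ≤ C)
    {σ : ℝ} (hσ : |σ| = 1) {ε η : ℝ} (hε : 0 < ε) (hη : 0 < η)
    (hmono : ∀ s s', |s - x| < η → |s' - x| < η → s ≠ x → s' ≠ x → σ * s ≤ σ * s' →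
      |f s| ≤ |f s'| + ε) :
    ∀ᶠ x' in 𝓝 x, 0 ≤ σ * (x - x') → ntMax α f x' ≤ ntMax α f x + ε := by
  have hC0 : 0 ≤ C := (abs_nonneg _).trans (hC 0)
  have hσσ : σ * σ = 1 := by rw [← abs_mul_abs_self, hσ, one_mul]
  have hlim : Tendsto (fun x' => C * |x - x'| / (η / 4)) (𝓝 x) (𝓝 0) := by
    have : Continuous fun x' => C * |x - x'| / (η / 4) := by fun_prop
    simpa using this.tendsto x
  have hlim' : Tendsto (fun x' => |x - x'|) (𝓝 x) (𝓝 0) := by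
    have : Continuous fun x' => |x - x'| := by fun_prop
    simpa using this.tendsto x
  filter_upwards [hlim.eventually_lt_const hε, hlim'.eventually_lt_const (half_pos hη)]
    with x' h1 h2 h3
  refine ntMax_le hα.1 fun y t ht hxy => ?_
  have hαt : α * t ≤ t := mul_le_of_le_one_left ht.le hα.2
  have hαt0 : 0 ≤ α * t := mul_nonneg hα.1 ht.le
  rcases lt_or_ge t (η / 4) with htη | htη
  · set c := x + σ * (α * t) - y with hc
    have hσαt : |σ * (α * t)| = α * t := by rw [abs_mul, hσ, one_mul, abs_of_nonneg hαt0]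
    have hσc : 0 ≤ σ * c := by
      have h4 : |σ * (x' - y)| ≤ α * t := by rwa [abs_mul, hσ, one_mul]
      have h5 : σ * c = σ * (x - x') + σ * (x' - y) + (σ * σ) * (α * t) := by rw [hc]; ring
      rw [h5, hσσ]
      linarith [(abs_le.1 h4).1]
    have hyc : avgAbs f (y + c) t ≤ ntMax α f x :=
      avgAbs_le_ntMax hC ht (by
        rw [show x - (y + c) = -(σ * (α * t)) by rw [hc]; ring, abs_neg, hσαt])
    have hi := intervalIntegrable_of_abs_le (f := fun s => |f s|) hf.abs (C := C)
      (fun x => by simpa using hC x)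
    have key : ∫ s in (y - t)..(y + t), |f s| ≤ ∫ s in (y - t)..(y + t), (|f (s + c)| + ε) := by
      refine intervalIntegral.integral_mono_ae_restrict (by linarith) (hi _ _) ?_ ?_
      · refine IntervalIntegrable.add ?_ intervalIntegrable_const
        exact intervalIntegrable_of_abs_le (f := fun s => |f (s + c)|) (by fun_prop) (C := C)
          (fun x => by simpa using hC _) _ _
      · have hne : ∀ z : ℝ, ∀ᵐ s ∂(volume : Measure ℝ), s ≠ z := fun z => by
          simp [ae_iff]
        filter_upwards [ae_restrict_mem measurableSet_Icc, ae_restrict_of_ae (hne x),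
          ae_restrict_of_ae (hne (x - c))] with s hs hsx hsc
        have b1 := abs_le.1 hxy
        have b2 := abs_lt.1 h2
        have b3 := abs_le.1 hσαt.le
        refine hmono s (s + c) (abs_lt.2 ⟨?_, ?_⟩) (abs_lt.2 ⟨?_, ?_⟩) hsx
          (fun h => hsc (by linarith)) ?_
        · linarith [hs.1]
        · linarith [hs.2]
        · linarith [hs.1]
        · linarith [hs.2]
        · rw [mul_add]; linarith
    rw [intervalIntegral.integral_add ((intervalIntegrable_of_abs_le (f := fun s => |f (s + c)|)
      (by fun_prop) (C := C) (fun x => by simpa using hC _) _ _)) intervalIntegrable_const,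
      intervalIntegral.integral_comp_add_right (fun s => |f s|), intervalIntegral.integral_const,
      show y - t + c = y + c - t by ring, show y + t + c = y + c + t by ring] at key
    refine le_trans ?_ (add_le_add_left hyc ε)
    rw [avgAbs, avgAbs, one_div, inv_mul_le_iff₀ (by positivity), mul_add,
      mul_inv_cancel_left₀ (by positivity)]
    simp only [smul_eq_mul] at key
    linarith
  · have h4 := abs_avgAbs_shift_sub_le (y := y) hf hC ht (x - x')
    have h5 : avgAbs f (y + (x - x')) t ≤ ntMax α f x :=
      avgAbs_le_ntMax hC ht (by rwa [show x - (y + (x - x')) = x' - y by ring])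
    have h6 : C * |x - x'| / t ≤ C * |x - x'| / (η / 4) := by gcongr
    linarith [(abs_le.1 h4).1]

end MaximalFunction

/-- The forward average `x ↦ ∫₀¹ f (x + h s) ds`, i.e. the mean of `f` over `[x, x + h]`. -/
noncomputable def forwardMean (h : ℝ) (f : ℝ → ℝ) (x : ℝ) : ℝ :=
  ∫ s in (0 : ℝ)..1, f (x + h * s)

section ForwardMean

variable {α C x y t h : ℝ} {f : ℝ → ℝ}

lemma abs_forwardMean_le (hC : ∀ x, |f x| ≤ C) (x : ℝ) : |forwardMean h f x| ≤ C := by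
  simpa [forwardMean] using intervalIntegral.norm_integral_le_of_norm_le_const (a := 0) (b := 1)
    (f := fun s => f (x + h * s)) fun s _ => hC _

lemma lipschitzWith_forwardMean (hf : Measurable f) (hC : ∀ x, |f x| ≤ C) (hh : 0 < h) :
    ∃ K : ℝ≥0, LipschitzWith K (forwardMean h f) := by
  have hC0 : 0 ≤ C := (abs_nonneg _).trans (hC 0)
  refine ⟨⟨h⁻¹ * (2 * C), by positivity⟩, LipschitzWith.of_dist_le_mul fun x y => ?_⟩
  have heq : ∀ z, forwardMean h f z = h⁻¹ * ∫ s in z..(z + h), f s := fun z => by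
    have := intervalIntegral.integral_comp_add_mul (a := 0) (b := 1) f hh.ne' z
    simpa [forwardMean] using this
  have := abs_integral_shift_sub_le hf hC y (y + h) (x - y)
  rw [show y + (x - y) = x by ring, show y + h + (x - y) = x + h by ring] at this
  rw [Real.dist_eq, Real.dist_eq, heq, heq, ← mul_sub, abs_mul, abs_of_pos (inv_pos.2 hh)]
  change _ ≤ h⁻¹ * (2 * C) * |x - y|
  rw [mul_assoc]
  gcongr

lemma eVariationOn_forwardMean_le (hf : Measurable f) (hC : ∀ x, |f x| ≤ C) :
    eVariationOn (forwardMean h f) univ ≤ eVariationOn f univ := by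
  refine iSup_le fun ⟨n, u, hu, _⟩ => ?_
  have hi : ∀ z, IntervalIntegrable (fun s => f (z + h * s)) volume 0 1 := fun z =>
    intervalIntegrable_of_abs_le (by fun_prop) (fun s => hC _) 0 1
  calc ∑ i ∈ Finset.range n, edist (forwardMean h f (u (i + 1))) (forwardMean h f (u i))
      ≤ ∑ i ∈ Finset.range n, ∫⁻ s in Ioc (0 : ℝ) 1,
          edist (f (u (i + 1) + h * s)) (f (u i + h * s)) := by
        gcongr with i
        rw [edist_eq_enorm_sub, forwardMean, forwardMean,
          ← intervalIntegral.integral_sub (hi _) (hi _),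
          intervalIntegral.integral_of_le zero_le_one]
        simp only [edist_eq_enorm_sub]
        exact enorm_integral_le_lintegral_enorm _
    _ = ∫⁻ s in Ioc (0 : ℝ) 1, ∑ i ∈ Finset.range n,
          edist (f (u (i + 1) + h * s)) (f (u i + h * s)) := by
        rw [lintegral_finsetSum]
        intro i _
        fun_prop
    _ ≤ ∫⁻ _ in Ioc (0 : ℝ) 1, eVariationOn f univ :=
        lintegral_mono fun s => eVariationOn.sum_le (f := f) (u := fun i => u i + h * s)
          (hu.add_const _) fun _ => mem_univ _
    _ = eVariationOn f univ := by simp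

lemma measurable_forwardMean (hf : Measurable f) : Measurable (forwardMean h f) := by
  have hm : StronglyMeasurable (Function.uncurry fun x s : ℝ => f (x + h * s)) :=
    (show Measurable fun p : ℝ × ℝ => f (p.1 + h * p.2) by fun_prop).stronglyMeasurable
  unfold forwardMean
  simp only [intervalIntegral.integral_of_le zero_le_one]
  exact hm.integral_prod_right.measurable

lemma avgAbs_forwardMean_le (hf : Measurable f) (hC : ∀ x, |f x| ≤ C) (ht : 0 < t) :
    avgAbs (forwardMean h f) y t ≤ ∫ s in (0 : ℝ)..1, avgAbs f (y + h * s) t := by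
  have hmeas : Measurable (Function.uncurry fun x s : ℝ => |f (x + h * s)|) :=
    show Measurable fun p : ℝ × ℝ => |f (p.1 + h * p.2)| by fun_prop
  have hint : IntegrableOn (Function.uncurry fun x s : ℝ => |f (x + h * s)|)
      (uIoc (y - t) (y + t) ×ˢ uIoc 0 1) := by
    refine Measure.integrableOn_of_bounded (M := C) ?_ hmeas.aestronglyMeasurable ?_
    · rw [Measure.volume_eq_prod, Measure.prod_prod]
      simp [uIoc, Real.volume_Ioc]
    · exact Eventually.of_forall fun p => by simpa [Function.uncurry] using hC _
  have hshift : ∀ s, avgAbs f (y + h * s) t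
      = 1 / (2 * t) * ∫ u in (y - t)..(y + t), |f (u + h * s)| := fun s => by
    rw [intervalIntegral.integral_comp_add_right (fun u => |f u|), avgAbs,
      show y - t + h * s = y + h * s - t by ring, show y + t + h * s = y + h * s + t by ring]
  simp only [hshift]
  rw [intervalIntegral.integral_const_mul, ← intervalIntegral_intervalIntegral_swap hint, avgAbs]
  gcongr
  refine intervalIntegral.integral_mono_on (by linarith) ?_ ?_ fun u _ => ?_
  · exact intervalIntegrable_of_abs_le (f := fun u => |forwardMean h f u|)
      (measurable_forwardMean hf).abs (C := C) (fun u => by simpa using abs_forwardMean_le hC u) _ _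
  · have hm : Measurable (forwardMean h fun u => |f u|) := measurable_forwardMean hf.abs
    exact intervalIntegrable_of_abs_le hm (C := C) (abs_forwardMean_le (f := fun u => |f u|)
      fun u => by simpa using hC u) _ _
  · exact intervalIntegral.abs_integral_le_integral_abs zero_le_one

lemma tendsto_forwardMean (hf : Measurable f) (hC : ∀ x, |f x| ≤ C) {h : ℕ → ℝ}
    (hh : Tendsto h atTop (𝓝 0)) (hx : ContinuousAt f x) :
    Tendsto (fun n => forwardMean (h n) f x) atTop (𝓝 (f x)) := by
  have := intervalIntegral.tendsto_integral_filter_of_dominated_convergence (a := 0) (b := 1)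
    (μ := volume) (l := atTop) (F := fun n s => f (x + h n * s)) (f := fun _ => f x) (fun _ => C)
    (Eventually.of_forall fun n => Measurable.aestronglyMeasurable (by fun_prop))
    (Eventually.of_forall fun n => Eventually.of_forall fun s _ => hC _)
    intervalIntegrable_const
    (Eventually.of_forall fun s _ => by
      refine hx.tendsto.comp ?_
      simpa using (hh.mul_const s).const_add x)
  simpa [forwardMean] using this

lemma tendsto_avgAbs_forwardMean (hf : Measurable f) (hC : ∀ x, |f x| ≤ C)
    (hcont : ∀ᵐ x, ContinuousAt f x) {h : ℕ → ℝ} (hh : Tendsto h atTop (𝓝 0)) (y t : ℝ) :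
    Tendsto (fun n => avgAbs (forwardMean (h n) f) y t) atTop (𝓝 (avgAbs f y t)) := by
  refine Tendsto.const_mul _ ?_
  refine intervalIntegral.tendsto_integral_filter_of_dominated_convergence (fun _ => C)
    (Eventually.of_forall fun n => (measurable_forwardMean hf).abs.aestronglyMeasurable)
    (Eventually.of_forall fun n => Eventually.of_forall fun s _ => ?_)
    intervalIntegrable_const ?_
  · simpa using abs_forwardMean_le hC s
  · filter_upwards [hcont] with s hs _
    exact (tendsto_forwardMean hf hC hh hs).abs

lemma tendsto_ntMax_forwardMean (hα : α ∈ Icc (0 : ℝ) 1) (hf : Measurable f)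
    (hC : ∀ x, |f x| ≤ C) (hcont : ∀ᵐ x, ContinuousAt f x) {h : ℕ → ℝ}
    (hh : Tendsto h atTop (𝓝 0)) (hx : ContinuousAt f x) :
    Tendsto (fun n => ntMax α (forwardMean (h n) f) x) atTop (𝓝 (ntMax α f x)) := by
  refine tendsto_order.2 ⟨fun r hr => ?_, fun r hr => ?_⟩
  · obtain ⟨y, t, ht, hxy, hlt⟩ := exists_lt_avgAbs hα.1 hr
    filter_upwards [(tendsto_avgAbs_forwardMean hf hC hcont hh y t).eventually_const_lt hlt]
      with n hn
    exact hn.trans_le (avgAbs_le_ntMax (abs_forwardMean_le hC) ht hxy)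
  · obtain ⟨ε, hε, hεr⟩ : ∃ ε, 0 < ε ∧ ntMax α f x + ε < r :=
      ⟨(r - ntMax α f x) / 2, by linarith, by linarith⟩
    obtain ⟨η, hη, hclose⟩ := Metric.continuousAt_iff.1 hx (ε / 2) (half_pos hε)
    have hmono : ∀ s s', |s - x| < η → |s' - x| < η → |f s| ≤ |f s'| + ε := fun s s' hs hs' => by
      have h1 := hclose hs
      have h2 := hclose hs'
      rw [Real.dist_eq] at h1 h2
      have h3 := abs_sub_abs_le_abs_sub (f s) (f x)
      have h4 := abs_sub_abs_le_abs_sub (f x) (f s')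
      rw [abs_sub_comm (f x)] at h4
      linarith
    have hle : ∀ᶠ x' in 𝓝 x, ntMax α f x' ≤ ntMax α f x + ε := by
      filter_upwards [ntMax_eventually_le hα hf hC (σ := 1) (by simp) hε hη
        fun s s' hs hs' _ _ _ => hmono s s' hs hs', ntMax_eventually_le hα hf hC (σ := -1)
        (by simp) hε hη fun s s' hs hs' _ _ _ => hmono s s' hs hs'] with x' h1 h2
      rcases le_total x' x with h | h
      · exact h1 (by linarith)
      · exact h2 (by linarith)
    obtain ⟨δ, hδ, hball⟩ := Metric.eventually_nhds_iff.1 hle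
    filter_upwards [hh.abs.eventually_lt_const (by simpa using hδ)] with n hn
    refine lt_of_le_of_lt (ntMax_le hα.1 fun y t ht hxy => ?_) hεr
    refine (avgAbs_forwardMean_le hf hC ht).trans ?_
    have hbound : ∀ s ∈ Icc (0 : ℝ) 1, avgAbs f (y + h n * s) t ≤ ntMax α f x + ε := fun s hs => by
      refine (avgAbs_le_ntMax (x := x + h n * s) hC ht ?_).trans (hball ?_)
      · rwa [add_sub_add_right_eq_sub]
      · rw [Real.dist_eq, add_sub_cancel_left, abs_mul, abs_of_nonneg hs.1]
        exact (mul_le_of_le_one_right (abs_nonneg _) hs.2).trans_lt hn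
    have hcontAvg : Continuous fun z => avgAbs f z t := by
      have hC0 : 0 ≤ C := (abs_nonneg _).trans (hC 0)
      refine (LipschitzWith.of_dist_le_mul (K := ⟨C / t, by positivity⟩) fun a b => ?_).continuous
      have := abs_avgAbs_shift_sub_le (y := b) hf hC ht (a - b)
      rw [add_sub_cancel] at this
      rw [Real.dist_eq, Real.dist_eq]
      exact this.trans (le_of_eq (by change _ = C / t * _; ring))
    have hmean := intervalIntegral.integral_mono_on (μ := volume) zero_le_one
      (Continuous.intervalIntegrable (u := fun s => avgAbs f (y + h n * s) t) (by fun_prop) _ _)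
      intervalIntegrable_const hbound
    simpa using hmean

end ForwardMean

lemma eVariationOn_univ_le_of_exists_seq {g : ℝ → ℝ} {D : Set ℝ}
    (hD : ∀ x, ∃ d : ℕ → ℝ, (∀ k, d k ∈ D) ∧ Tendsto d atTop (𝓝 x) ∧
      Tendsto (fun k => g (d k)) atTop (𝓝 (g x))) :
    eVariationOn g univ ≤ eVariationOn g D := by
  choose d hdD hd hgd using hD
  rw [eVariationOn.eVariationOn_eq_strictMonoOn]
  refine iSup_le fun ⟨n, u, hu, _⟩ => ?_
  have hlim : Tendsto (fun k => ∑ i ∈ Finset.range n, edist (g (d (u (i + 1)) k)) (g (d (u i) k)))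
      atTop (𝓝 (∑ i ∈ Finset.range n, edist (g (u (i + 1))) (g (u i)))) :=
    tendsto_finsetSum _ fun i _ => (hgd _).edist (hgd _)
  have hmono : ∀ᶠ k in atTop, ∀ i ∈ Iic n, ∀ j ∈ Iic n, i < j → d (u i) k < d (u j) k := by
    simp only [(finite_Iic n).eventually_all]
    intro i hi j hj
    by_cases hij : i < j
    · filter_upwards [(hd (u i)).eventually_lt (hd (u j)) (hu hi hj hij)] with k hk _ using hk
    · simp [hij]
  refine le_of_tendsto hlim ?_
  filter_upwards [hmono] with k hk
  exact eVariationOn.sum_le_of_monotoneOn_Iic (f := g) (u := fun i => d (u i) k)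
    (StrictMonoOn.monotoneOn fun i hi j hj hij => hk i hi j hj hij) fun i _ => hdD _ _

section BoundedVariation

variable {α x : ℝ} {f : ℝ → ℝ}

lemma BoundedVariationOn.exists_abs_le (hf : BoundedVariationOn f univ) :
    ∃ C, ∀ x, |f x| ≤ C := by
  refine ⟨(eVariationOn f univ).toReal + |f 0|, fun x => ?_⟩
  have h1 := hf.dist_le (mem_univ x) (mem_univ 0)
  rw [Real.dist_eq] at h1
  linarith [abs_sub_abs_le_abs_sub (f x) (f 0)]

lemma BoundedVariationOn.measurable_real (hf : BoundedVariationOn f univ) : Measurable f := by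
  obtain ⟨p, q, hp, hq, rfl⟩ := hf.locallyBoundedVariationOn.exists_monotoneOn_sub_monotoneOn
  exact (monotoneOn_univ.1 hp).measurable.sub (monotoneOn_univ.1 hq).measurable

lemma BoundedVariationOn.ae_continuousAt (hf : BoundedVariationOn f univ) :
    ∀ᵐ x, ContinuousAt f x :=
  hf.locallyBoundedVariationOn.ae_differentiableAt.mono fun _ h => h.continuousAt

/-- Near each point, the absolute value of a function of bounded variation is nearly monotone in
the direction of its larger one-sided limit. -/
lemma BoundedVariationOn.exists_direction (hf : BoundedVariationOn f univ) (x : ℝ) :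
    ∃ σ : ℝ, (σ = 1 ∨ σ = -1) ∧ ∀ ε > 0, ∃ η > 0, ∀ s s', |s - x| < η → |s' - x| < η →
      s ≠ x → s' ≠ x → σ * s ≤ σ * s' → |f s| ≤ |f s'| + ε := by
  obtain ⟨a, ha⟩ := hf.exists_tendsto_left x
  obtain ⟨b, hb⟩ := hf.exists_tendsto_right x
  rw [univ_inter] at ha hb
  have hnear : ∀ ε > 0, ∃ η > 0, (∀ s, |s - x| < η → s < x → |(|f s| - |a|)| < ε / 2) ∧
      ∀ s, |s - x| < η → x < s → |(|f s| - |b|)| < ε / 2 := fun ε hε => by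
    obtain ⟨η₁, h₁, H₁⟩ := Metric.eventually_nhds_iff.1 (eventually_nhdsWithin_iff.1
      (Metric.tendsto_nhds.1 ha.abs (ε / 2) (half_pos hε)))
    obtain ⟨η₂, h₂, H₂⟩ := Metric.eventually_nhds_iff.1 (eventually_nhdsWithin_iff.1
      (Metric.tendsto_nhds.1 hb.abs (ε / 2) (half_pos hε)))
    exact ⟨min η₁ η₂, lt_min h₁ h₂, fun s hs hsx => H₁ (hs.trans_le (min_le_left _ _)) hsx,
      fun s hs hsx => H₂ (hs.trans_le (min_le_right _ _)) hsx⟩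
  rcases le_total |a| |b| with hab | hab
  · refine ⟨1, Or.inl rfl, fun ε hε => ?_⟩
    obtain ⟨η, hη, hl, hr⟩ := hnear ε hε
    refine ⟨η, hη, fun s s' hs hs' hsx hsx' hle => ?_⟩
    rcases hsx.lt_or_gt with h | h <;> rcases hsx'.lt_or_gt with h' | h'
    · linarith [(abs_lt.1 (hl s hs h)).2, (abs_lt.1 (hl s' hs' h')).1]
    · linarith [(abs_lt.1 (hl s hs h)).2, (abs_lt.1 (hr s' hs' h')).1]
    · linarith
    · linarith [(abs_lt.1 (hr s hs h)).2, (abs_lt.1 (hr s' hs' h')).1]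
  · refine ⟨-1, Or.inr rfl, fun ε hε => ?_⟩
    obtain ⟨η, hη, hl, hr⟩ := hnear ε hε
    refine ⟨η, hη, fun s s' hs hs' hsx hsx' hle => ?_⟩
    rcases hsx.lt_or_gt with h | h <;> rcases hsx'.lt_or_gt with h' | h'
    · linarith [(abs_lt.1 (hl s hs h)).2, (abs_lt.1 (hl s' hs' h')).1]
    · linarith
    · linarith [(abs_lt.1 (hr s hs h)).2, (abs_lt.1 (hl s' hs' h')).1]
    · linarith [(abs_lt.1 (hr s hs h)).2, (abs_lt.1 (hr s' hs' h')).1]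

lemma BoundedVariationOn.exists_seq_tendsto_ntMax (hα : α ∈ Icc (0 : ℝ) 1)
    (hf : BoundedVariationOn f univ) (x : ℝ) :
    ∃ d : ℕ → ℝ, (∀ k, d k ∈ {z | ContinuousAt f z}) ∧ Tendsto d atTop (𝓝 x) ∧
      Tendsto (fun k => ntMax α f (d k)) atTop (𝓝 (ntMax α f x)) := by
  obtain ⟨C, hC⟩ := hf.exists_abs_le
  have hm := hf.measurable_real
  obtain ⟨σ, hσ, hdir⟩ := hf.exists_direction x
  have hσ1 : |σ| = 1 := by rcases hσ with rfl | rfl <;> simp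
  have hdense : Dense {z | ContinuousAt f z} := Measure.dense_of_ae hf.ae_continuousAt
  have hex : ∀ k : ℕ, ∃ z, ContinuousAt f z ∧ |z - x| < 1 / ((k : ℝ) + 1) ∧
      |ntMax α f z - ntMax α f x| ≤ 1 / ((k : ℝ) + 1) := fun k => by
    have hε : 0 < 1 / ((k : ℝ) + 1) := Nat.one_div_pos_of_nat
    obtain ⟨η, hη, hmono⟩ := hdir _ hε
    obtain ⟨δ, hδ, hball⟩ := Metric.eventually_nhds_iff.1
      ((ntMax_eventually_ge hα.1 hm hC x hε).and
        (ntMax_eventually_le hα hm hC hσ1 hε hη hmono))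
    set ρ := min δ (1 / ((k : ℝ) + 1)) with hρ
    have hρ0 : 0 < ρ := lt_min hδ hε
    obtain ⟨z, hz, hzx, hzσ⟩ : ∃ z, ContinuousAt f z ∧ |z - x| < ρ ∧ 0 ≤ σ * (x - z) := by
      rcases hσ with rfl | rfl
      · obtain ⟨z, hz, h1, h2⟩ := hdense.exists_between (show x - ρ < x by linarith)
        exact ⟨z, hz, abs_lt.2 ⟨by linarith, by linarith⟩, by linarith⟩
      · obtain ⟨z, hz, h1, h2⟩ := hdense.exists_between (show x < x + ρ by linarith)
        exact ⟨z, hz, abs_lt.2 ⟨by linarith, by linarith⟩, by linarith⟩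
    obtain ⟨h1, h2⟩ := hball (y := z) (hzx.trans_le (min_le_left _ _))
    exact ⟨z, hz, hzx.trans_le (min_le_right _ _),
      abs_le.2 ⟨by linarith, by linarith [h2 hzσ]⟩⟩
  choose d hd hdx hdM using hex
  refine ⟨d, hd, ?_, ?_⟩
  · exact tendsto_iff_dist_tendsto_zero.2 (squeeze_zero (fun _ => dist_nonneg)
      (fun k => (hdx k).le) tendsto_one_div_add_atTop_nhds_zero_nat)
  · exact tendsto_iff_dist_tendsto_zero.2 (squeeze_zero (fun _ => dist_nonneg)
      hdM tendsto_one_div_add_atTop_nhds_zero_nat)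

end BoundedVariation

/-- **Reduction to the Lipschitz case.** Fix `α ∈ [0,1]`. If `V(M^α f) ≤ V(f)` holds for every
Lipschitz function `f` of bounded variation, then it holds for every function of bounded
variation normalized so that `f(x) = limsup_{y → x} f(y)` for all `x`. -/
theorem reduction_to_lipschitz (α : ℝ) (hα : α ∈ Set.Icc (0 : ℝ) 1)
    (H : ∀ f : ℝ → ℝ, (∃ K : ℝ≥0, LipschitzWith K f) → BoundedVariationOn f Set.univ →
      eVariationOn (ntMax α f) Set.univ ≤ eVariationOn f Set.univ) :
    ∀ f : ℝ → ℝ, BoundedVariationOn f Set.univ →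
      (∀ x : ℝ, f x = Filter.limsup f (𝓝[≠] x)) →
      eVariationOn (ntMax α f) Set.univ ≤ eVariationOn f Set.univ := by
  intro f hf _
  obtain ⟨C, hC⟩ := hf.exists_abs_le
  have hm := hf.measurable_real
  refine (eVariationOn_univ_le_of_exists_seq (hf.exists_seq_tendsto_ntMax hα)).trans ?_
  refine le_of_forall_lt fun v hv => ?_
  obtain ⟨n, hn⟩ := (eVariationOn.lowerSemicontinuous_aux
    (fun x hx => tendsto_ntMax_forwardMean hα hm hC hf.ae_continuousAt
      tendsto_one_div_add_atTop_nhds_zero_nat hx) hv).exists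
  have hvar := eVariationOn_forwardMean_le (h := 1 / ((n : ℝ) + 1)) hm hC
  calc v < _ := hn
    _ ≤ _ := eVariationOn.mono _ (subset_univ _)
    _ ≤ _ := H _ (lipschitzWith_forwardMean hm hC Nat.one_div_pos_of_nat)
      (ne_top_of_le_ne_top hf hvar)
    _ ≤ _ := hvar
end

section
/- Let μ = δ_0 + δ_1 be the sum of the Dirac measures at 0 and 1, and for α ≥ 0 define M^α μ(x) = sup{ μ([y-t, y+t])/(2t) : t > 0, |x-y| ≤ α t }. Then for every 0 ≤ α < 1/3 one has M^α μ(0) = +∞, M^α μ(1/3) = M^α μ(2/3) = 3(1+α)/2, and M^α μ(1/2) ≥ 2 > 3(1+α)/2. In particular M^α μ has a nontrivial local maximum: M^α μ(0) > M^α μ(1/3) < M^α μ(1/2) > M^α μ(2/3). -/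
open MeasureTheory Set Filter Topology NNReal ENNReal

/-- The nontangential maximal function of a measure:
`M^α μ (x) = sup { μ([y-t, y+t]) / (2t) : 0 < t, |x - y| ≤ α t }`. -/
noncomputable def measNtMax (α : ℝ) (μ : MeasureTheory.Measure ℝ) (x : ℝ) : ℝ≥0∞ :=
  ⨆ (y : ℝ) (t : ℝ) (_ : 0 < t ∧ |x - y| ≤ α * t),
    μ (Set.Icc (y - t) (y + t)) / ENNReal.ofReal (2 * t)

/-- The measure `μ = δ₀ + δ₁`. -/
noncomputable def diracSum : MeasureTheory.Measure ℝ :=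
  MeasureTheory.Measure.dirac 0 + MeasureTheory.Measure.dirac 1

lemma diracSum_Icc (a b : ℝ) :
    diracSum (Icc a b) = ENNReal.ofReal
      ((if a ≤ 0 ∧ 0 ≤ b then 1 else 0) + (if a ≤ 1 ∧ 1 ≤ b then 1 else 0)) := by
  rw [diracSum, Measure.add_apply, Measure.dirac_apply' _ measurableSet_Icc,
    Measure.dirac_apply' _ measurableSet_Icc, ENNReal.ofReal_add (by split_ifs <;> norm_num)
      (by split_ifs <;> norm_num)]
  simp only [Set.indicator_apply, mem_Icc, Pi.one_apply]
  congr 1 <;> split_ifs <;> simp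

lemma le_measNtMax {α x y t : ℝ} (μ : Measure ℝ) (ht : 0 < t) (hxy : |x - y| ≤ α * t) :
    μ (Icc (y - t) (y + t)) / ENNReal.ofReal (2 * t) ≤ measNtMax α μ x :=
  le_iSup_of_le y (le_iSup_of_le t (le_iSup_of_le ⟨ht, hxy⟩ le_rfl))

lemma ofReal_le_measNtMax_diracSum {α x y t m : ℝ} (ht : 0 < t) (hxy : |x - y| ≤ α * t)
    (hm : m ≤ (if y - t ≤ 0 ∧ 0 ≤ y + t then 1 else 0) +
      (if y - t ≤ 1 ∧ 1 ≤ y + t then 1 else 0)) :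
    ENNReal.ofReal (m / (2 * t)) ≤ measNtMax α diracSum x := by
  refine le_trans ?_ (le_measNtMax diracSum ht hxy)
  rw [diracSum_Icc, ENNReal.ofReal_div_of_pos (by positivity)]
  gcongr

lemma measNtMax_diracSum_zero {α : ℝ} (hα : 0 ≤ α) : measNtMax α diracSum 0 = ⊤ := by
  refine ENNReal.eq_top_of_forall_nnreal_le fun r => ?_
  have ht : (0 : ℝ) < 1 / (2 * (r + 1)) := by positivity
  have h := ofReal_le_measNtMax_diracSum (α := α) (x := 0) (y := 0) (m := 1) ht
    (by simpa using mul_nonneg hα ht.le) (by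
      rw [if_pos ⟨by linarith, by linarith⟩]
      split_ifs <;> norm_num)
  refine le_trans ?_ h
  rw [← ENNReal.ofReal_coe_nnreal]
  apply ENNReal.ofReal_le_ofReal
  field_simp
  linarith

lemma measNtMax_diracSum_le {α x : ℝ} (hα : 0 ≤ α) (hx : x = 1 / 3 ∨ x = 2 / 3) :
    measNtMax α diracSum x ≤ ENNReal.ofReal (3 * (1 + α) / 2) := by
  refine iSup_le fun y => iSup_le fun t => iSup_le fun ⟨ht, hxy⟩ => ?_
  apply ENNReal.div_le_of_le_mul
  rw [diracSum_Icc, ← ENNReal.ofReal_mul (by positivity)]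
  apply ENNReal.ofReal_le_ofReal
  obtain ⟨h₁, h₂⟩ := abs_le.mp hxy
  have := mul_nonneg hα ht.le
  rcases hx with rfl | rfl <;> split_ifs <;> grind

lemma measNtMax_diracSum_eq {α x : ℝ} (hα : 0 ≤ α) (hx : x = 1 / 3 ∨ x = 2 / 3) :
    measNtMax α diracSum x = ENNReal.ofReal (3 * (1 + α) / 2) := by
  refine le_antisymm (measNtMax_diracSum_le hα hx) ?_
  have ht : (0 : ℝ) < 1 / (3 * (1 + α)) := by positivity
  have hs : α * (1 / (3 * (1 + α))) = 1 / 3 - 1 / (3 * (1 + α)) := by field_simp; ring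
  have hc : 3 * (1 + α) / 2 = 1 / (2 * (1 / (3 * (1 + α)))) := by field_simp
  have hn := mul_nonneg hα ht.le
  rw [hc]
  rcases hx with rfl | rfl
  · refine ofReal_le_measNtMax_diracSum (y := 1 / (3 * (1 + α))) ht ?_ ?_
    · rw [← hs, abs_of_nonneg hn]
    · rw [if_pos ⟨by linarith, by linarith⟩]
      split_ifs <;> norm_num
  · refine ofReal_le_measNtMax_diracSum (y := 1 - 1 / (3 * (1 + α))) ht ?_ ?_
    · rw [abs_le]
      constructor <;> linarith
    · rw [if_pos (c := _ ∧ 1 ≤ _) ⟨by linarith, by linarith⟩]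
      split_ifs <;> norm_num

lemma two_le_measNtMax_diracSum_half {α : ℝ} (hα : 0 ≤ α) :
    2 ≤ measNtMax α diracSum (1 / 2) := by
  have h := ofReal_le_measNtMax_diracSum (α := α) (x := 1 / 2) (y := 1 / 2) (t := 1 / 2) (m := 2)
    (by norm_num) (by simpa using hα) (by norm_num)
  simpa using h

/-- For `μ = δ₀ + δ₁` and `0 ≤ α < 1/3`, one has `M^α μ(0) = ∞`,
`M^α μ(1/3) = M^α μ(2/3) = 3(1+α)/2`, and `M^α μ(1/2) ≥ 2 > 3(1+α)/2`.
In particular, `M^α μ` has a nontrivial local maximum: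
`M^α μ(0) > M^α μ(1/3) < M^α μ(1/2) > M^α μ(2/3)`. -/
theorem measNtMax_diracSum_local_max (α : ℝ) (hα0 : 0 ≤ α) (hα : α < 1 / 3) :
    measNtMax α diracSum 0 = ⊤ ∧
    measNtMax α diracSum (1 / 3) = ENNReal.ofReal (3 * (1 + α) / 2) ∧
    measNtMax α diracSum (2 / 3) = ENNReal.ofReal (3 * (1 + α) / 2) ∧
    (2 : ℝ≥0∞) ≤ measNtMax α diracSum (1 / 2) ∧
    ENNReal.ofReal (3 * (1 + α) / 2) < 2 ∧
    measNtMax α diracSum (1 / 3) < measNtMax α diracSum 0 ∧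
    measNtMax α diracSum (1 / 3) < measNtMax α diracSum (1 / 2) ∧
    measNtMax α diracSum (2 / 3) < measNtMax α diracSum (1 / 2) := by
  have hlt : ENNReal.ofReal (3 * (1 + α) / 2) < 2 := by
    rw [← ENNReal.ofReal_ofNat 2, ENNReal.ofReal_lt_ofReal_iff (by norm_num)]
    linarith
  have h₁ := measNtMax_diracSum_eq hα0 (Or.inl rfl)
  have h₂ := measNtMax_diracSum_eq hα0 (Or.inr rfl)
  have hhalf := two_le_measNtMax_diracSum_half hα0
  have hzero := measNtMax_diracSum_zero hα0
  refine ⟨hzero, h₁, h₂, hhalf, hlt, ?_, ?_, ?_⟩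
  · rw [hzero, h₁]
    exact ENNReal.ofReal_lt_top
  · rw [h₁]
    exact hlt.trans_le hhalf
  · rw [h₂]
    exact hlt.trans_le hhalf
end
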